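/- Let k be a field and let t_1, ..., t_d be distinct integers with 0 ≤ t_i ≤ p, where p is an odd prime. Let X be a d×d upper triangular matrix with entries in the polynomial ring k[u] such that the i-th diagonal entry of X is u^{t_i} and, for each i < j, the (i,j)-entry x_{i,j} is a polynomial of degree strictly less than t_j. Let A ∈ GL_d(k) be an invertible matrix with constant entries. Assume that for every i, u^{t_i} divides every entry of the i-th column of the product X·A. Then for all i < j one has x_{i,j} = u^{t_i}·y_{i,j}, where y_{i,j} = 0 whenever t_j < t_i, and y_{i,j} is a constant in k whenever t_j > t_i. -/

import Mathlib

open Polynomial in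
theorem aux_last {k : Type*} [Field k] {d : ℕ} (t : Fin d → ℕ)
    (M : Matrix (Fin d) (Fin d) (Polynomial k))
    (hX_lower : ∀ i j : Fin d, j < i → M i j = 0)
    (hX_diag : ∀ i : Fin d, M i i = Polynomial.X ^ (t i))
    (m n : ℕ) (v : Fin d → k)
    (hv : ∀ l, (Polynomial.X : Polynomial k) ^ m ∣ ∑ i, M l i * Polynomial.C (v i))
    (h0 : ∀ i : Fin d, n ≤ i.val → m ≤ t i → v i = 0) :
    ∀ i : Fin d, n ≤ i.val → v i = 0 := by
  have key : ∀ r : ℕ, ∀ i : Fin d, d - i.val = r → n ≤ i.val → v i = 0 := by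
    intro r
    induction r using Nat.strong_induction_on with
    | _ r ih =>
      intro i hr hn
      by_cases hm : m ≤ t i
      · exact h0 i hn hm
      have h1 := hv i
      rw [Finset.sum_eq_single i] at h1
      · rw [hX_diag, Polynomial.X_pow_dvd_iff] at h1
        have := h1 (t i) (by omega)
        simpa using this
      · intro b _ hb
        rcases lt_or_gt_of_ne hb with h | h
        · rw [hX_lower _ _ h, zero_mul]
        · have hlt : i.val < b.val := h
          have := b.isLt
          rw [ih (d - b.val) (by omega) b rfl (by omega)]
          simp
      · simp
  intro i hi
  exact key _ i rfl hi

theorem aux_exists {k : Type*} [Field k] {d : ℕ} (t : Fin d → ℕ)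
    (M : Matrix (Fin d) (Fin d) (Polynomial k))
    (hX_lower : ∀ i j : Fin d, j < i → M i j = 0)
    (hX_diag : ∀ i : Fin d, M i i = Polynomial.X ^ (t i))
    (A : Matrix (Fin d) (Fin d) k) (hA : IsUnit A.det)
    (hdvd : ∀ i j : Fin d,
      (Polynomial.X : Polynomial k) ^ (t i) ∣ (M * A.map Polynomial.C) j i) (j : Fin d) :
    ∃ v : Fin d → k, v j = 1 ∧ (∀ i, j < i → v i = 0) ∧ (∀ i, i ≠ j → t j ≤ t i → v i = 0) ∧
      ∀ l, (Polynomial.X : Polynomial k) ^ (t j) ∣ ∑ i, M l i * Polynomial.C (v i) := by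
  classical
  have hV : ∀ w : Fin d → k, (∀ i, ¬ t j ≤ t i → w i = 0) → ∀ l,
      (Polynomial.X : Polynomial k) ^ (t j) ∣ ∑ i, M l i * Polynomial.C (A.mulVec w i) := by
    intro w hw l
    have e : ∑ i, M l i * Polynomial.C (A.mulVec w i)
        = ∑ c, (M * A.map Polynomial.C) l c * Polynomial.C (w c) := by
      simp only [Matrix.mulVec, dotProduct, Matrix.mul_apply, Matrix.map_apply, map_sum, map_mul,
        Finset.mul_sum, Finset.sum_mul]
      rw [Finset.sum_comm]
      simp only [mul_assoc]
    rw [e]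
    refine Finset.dvd_sum fun c _ => ?_
    by_cases hc : t j ≤ t c
    · exact Dvd.dvd.mul_right ((pow_dvd_pow _ hc).trans (hdvd c l)) _
    · rw [hw c hc]; simp
  let g : (Fin d → k) →ₗ[k] (Fin d → k) :=
    { toFun := fun w i => if t j ≤ t i then A.mulVec w i else w i
      map_add' := by
        intro x y; ext i; by_cases h : t j ≤ t i <;> simp [h, Matrix.mulVec_add]
      map_smul' := by
        intro c x; ext i; by_cases h : t j ≤ t i <;> simp [h, Matrix.mulVec_smul] }
  have hg : ∀ w i, g w i = if t j ≤ t i then A.mulVec w i else w i := fun _ _ => rfl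
  have hinj : Function.Injective g := by
    rw [injective_iff_map_eq_zero]
    intro w hw
    have hw' : ∀ i, (if t j ≤ t i then A.mulVec w i else w i) = 0 := fun i => by
      rw [← hg, hw]; rfl
    have hoff : ∀ i, ¬ t j ≤ t i → w i = 0 := fun i hi => by simpa [hi] using hw' i
    have hz := aux_last t M hX_lower hX_diag (t j) 0 (A.mulVec w) (hV w hoff)
      (fun i _ hi => by simpa [hi] using hw' i)
    have hz' : A.mulVec w = 0 := funext fun i => hz i (Nat.zero_le _)
    have hu : IsUnit A := (Matrix.isUnit_iff_isUnit_det A).2 hA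
    exact (Matrix.mulVec_injective_iff_isUnit.2 hu) (by rw [hz', Matrix.mulVec_zero])
  obtain ⟨w, hw⟩ := (LinearMap.injective_iff_surjective.1 hinj) (Pi.single j 1)
  have hw' : ∀ i, (if t j ≤ t i then A.mulVec w i else w i) = Pi.single (M := fun _ => k) j 1 i :=
    fun i => by rw [← hg, hw]
  have hoff : ∀ i, ¬ t j ≤ t i → w i = 0 := fun i hi => by
    have h := hw' i
    have hij : i ≠ j := by rintro rfl; exact hi le_rfl
    simpa [hi, hij] using h
  have hon : ∀ i, i ≠ j → t j ≤ t i → A.mulVec w i = 0 := fun i hij hi => by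
    simpa [hi, hij] using hw' i
  refine ⟨A.mulVec w, by simpa using hw' j, ?_, hon, hV w hoff⟩
  intro i hi
  refine aux_last t M hX_lower hX_diag (t j) (j.val + 1) (A.mulVec w) (hV w hoff) ?_ i hi
  intro i hi hm
  exact hon i (by rintro rfl; omega) hm


/-- key matrix lemma, Lemma `shapelemma` of the paper.
Let `k` be a field, `p` an odd prime, and `t₁, …, t_d` distinct integers in `[0, p]`.
Let `X` be an upper triangular `d × d` matrix over `k[u]` with `i`-th diagonal entry
`u ^ (t i)` and `(i,j)`-entries of degree `< t j` for `i < j`, and let `A ∈ GL_d(k)`.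
If `u ^ (t i)` divides every entry of the `i`-th column of `X · A`, then for `i < j`
we have `X i j = y * u ^ (t i)` with `y = 0` when `t j < t i` and `y` a constant when
`t j > t i`. -/
theorem stmt0 {k : Type*} [Field k] {p d : ℕ} (hp : p.Prime) (hodd : Odd p)
    (t : Fin d → ℕ) (ht_inj : Function.Injective t) (ht_le : ∀ i, t i ≤ p)
    (X : Matrix (Fin d) (Fin d) (Polynomial k))
    (hX_lower : ∀ i j : Fin d, j < i → X i j = 0)
    (hX_diag : ∀ i : Fin d, X i i = Polynomial.X ^ (t i))
    (hX_deg : ∀ i j : Fin d, i < j → (X i j).degree < (t j : WithBot ℕ))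
    (A : Matrix (Fin d) (Fin d) k) (hA : IsUnit A.det)
    (hdvd : ∀ i j : Fin d,
      (Polynomial.X : Polynomial k) ^ (t i) ∣ (X * A.map Polynomial.C) j i) :
    ∀ i j : Fin d, i < j → ∃ y : k,
      X i j = Polynomial.C y * Polynomial.X ^ (t i) ∧ (t j < t i → y = 0) := by
  classical
  have main : ∀ n : ℕ, ∀ j : Fin d, j.val = n → ∀ i : Fin d, i < j → ∃ y : k,
      X i j = Polynomial.C y * Polynomial.X ^ (t i) ∧ (t j < t i → y = 0) := by
    intro n
    induction n using Nat.strong_induction_on with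
    | _ n ih =>
      intro j hj l hl
      obtain ⟨v, hvj, hgt, hge, hv⟩ := aux_exists t X hX_lower hX_diag A hA hdvd j
      have hsum : ∑ i, X l i * Polynomial.C (v i) = 0 := by
        refine Polynomial.eq_zero_of_dvd_of_degree_lt (hv l) ?_
        rw [Polynomial.degree_X_pow]
        refine (Polynomial.degree_sum_le _ _).trans_lt ?_
        rw [Finset.sup_lt_iff (WithBot.bot_lt_coe _)]
        intro i _
        by_cases hvi : v i = 0
        · rw [hvi]; simp
        rw [Polynomial.degree_mul_C hvi]
        by_cases hij : i = j
        · subst hij; exact hX_deg l i hl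
        have hti : t i < t j := by
          by_contra h; exact hvi (hge i hij (not_lt.1 h))
        have hti' : (t i : WithBot ℕ) < (t j : WithBot ℕ) := by exact_mod_cast hti
        rcases lt_trichotomy l i with h | h | h
        · exact (hX_deg l i h).trans hti'
        · subst h; rw [hX_diag, Polynomial.degree_X_pow]; exact hti'
        · rw [hX_lower _ _ h, Polynomial.degree_zero]; exact WithBot.bot_lt_coe _
      have hterm : ∀ i, ∃ y : k, i ≠ j → X l i * Polynomial.C (v i)
          = Polynomial.C y * Polynomial.X ^ (t l) ∧ (t j < t l → y = 0) := by
        intro i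
        by_cases hij : i = j
        · exact ⟨0, fun h => absurd hij h⟩
        by_cases hvi : v i = 0
        · exact ⟨0, fun _ => by simp [hvi]⟩
        have hti : t i < t j := by
          by_contra h; exact hvi (hge i hij (not_lt.1 h))
        have hlt : i < j := by
          by_contra h
          exact hvi (hgt i (lt_of_le_of_ne (not_lt.1 h) (Ne.symm hij)))
        rcases lt_trichotomy l i with h | h | h
        · obtain ⟨y, hy, hy0⟩ := ih i.val (hj ▸ hlt) i rfl l h
          refine ⟨y * v i, fun _ => ⟨?_, fun hh => ?_⟩⟩
          · rw [hy, Polynomial.C_mul]; ring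
          · rw [hy0 (hti.trans hh), zero_mul]
        · subst h
          refine ⟨v l, fun _ => ⟨?_, fun hh => ?_⟩⟩
          · rw [hX_diag, mul_comm]
          · exact absurd hh (not_lt.2 hti.le)
        · exact ⟨0, fun _ => by simp [hX_lower _ _ h]⟩
      choose y hy using hterm
      refine ⟨-∑ i ∈ Finset.univ.erase j, y i, ?_, ?_⟩
      · rw [← Finset.add_sum_erase _ _ (Finset.mem_univ j), hvj, Polynomial.C_1, mul_one] at hsum
        rw [eq_neg_of_add_eq_zero_left hsum, Polynomial.C_neg, neg_mul, map_sum, Finset.sum_mul]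
        congr 1
        exact Finset.sum_congr rfl fun i hi => (hy i (Finset.ne_of_mem_erase hi)).1
      · intro hh
        rw [Finset.sum_eq_zero fun i hi => (hy i (Finset.ne_of_mem_erase hi)).2 hh, neg_zero]
  intro i j hij
  exact main _ j rfl i hij
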